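/- arXiv:2309.06015 — 2 statements merged into one kernel-verified Lean document; each statement's English description precedes it below -/
import Mathlib

section
/- Consider the one-dimensional control system ẋ = θ₁ x³ + θ₂ x² with control parameter θ = (θ₁, θ₂) ∈ ℝ². For all positive integers M, N, all reals x_1 < x_2 < ⋯ < x_M < 0 < x_{M+1} < ⋯ < x_{M+N} and all reals y_1 < y_2 < ⋯ < y_M < 0 < y_{M+1} < ⋯ < y_{M+N}, there exist T > 0, a piecewise constant control θ : [0,T] → ℝ², and continuous curves γ_1, …, γ_{M+N} : [0,T] → ℝ solving γ̇_i(t) = θ₁(t) γ_i(t)³ + θ₂(t) γ_i(t)² at every non-switching time t, such that γ_i(0) = x_i and γ_i(T) = y_i for every i = 1, …, M+N. -/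
open Filter Topology Set

/-- `x` is carried to `y` in unit time by a constant control. -/
def CubicStep {ι : Type*} (x y : ι → ℝ) : Prop :=
  ∃ θ : ℝ × ℝ, ∃ γ : ι → ℝ → ℝ, ∀ i, γ i 0 = x i ∧ γ i 1 = y i ∧
    ∀ t ∈ Icc (0 : ℝ) 1, HasDerivAt (γ i) (θ.1 * γ i t ^ 3 + θ.2 * γ i t ^ 2) t

theorem CubicStep.symm {ι : Type*} {x y : ι → ℝ} (h : CubicStep x y) : CubicStep y x := by
  obtain ⟨θ, γ, h⟩ := h
  refine ⟨-θ, fun i t => γ i (1 - t), fun i => ⟨by simp [h i], by simp [h i], fun t ht => ?_⟩⟩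
  have h1 := (h i).2.2 (1 - t) ⟨by linarith [ht.2], by linarith [ht.1]⟩
  have h2 := h1.scomp t ((hasDerivAt_id t).const_sub 1)
  refine h2.congr_deriv ?_
  simp only [Prod.fst_neg, Prod.snd_neg, smul_eq_mul]
  ring

/-- Reachability by unit-time constant controls, in the coordinate `u = -1/x`. -/
def ReachRecip {ι : Type*} (u v : ι → ℝ) : Prop :=
  Relation.ReflTransGen CubicStep (fun i => -(u i)⁻¹) (fun i => -(v i)⁻¹)

theorem ReachRecip.refl {ι : Type*} (u : ι → ℝ) : ReachRecip u u := Relation.ReflTransGen.refl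

theorem ReachRecip.trans {ι : Type*} {u v w : ι → ℝ} (h : ReachRecip u v) (h' : ReachRecip v w) :
    ReachRecip u w := Relation.ReflTransGen.trans h h'

theorem ReachRecip.symm {ι : Type*} {u v : ι → ℝ} (h : ReachRecip u v) : ReachRecip v u := by
  have : Std.Symm (CubicStep (ι := ι)) := ⟨fun _ _ => CubicStep.symm⟩
  exact Std.Symm.symm (r := Relation.ReflTransGen CubicStep) _ _ h

/-- In the coordinate `u = -1/x` the system reads `u' = θ₂ - θ₁ / u`. -/
theorem reachRecip_of_hasDerivAt {ι : Type*} {u v : ι → ℝ} (a b : ℝ) (w : ι → ℝ → ℝ)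
    (h0 : ∀ i, w i 0 = u i) (h1 : ∀ i, w i 1 = v i)
    (hne : ∀ i, ∀ t ∈ Icc (0 : ℝ) 1, w i t ≠ 0)
    (hw : ∀ i, ∀ t ∈ Icc (0 : ℝ) 1, HasDerivAt (w i) (b - a / w i t) t) : ReachRecip u v := by
  refine Relation.ReflTransGen.single
    ⟨(a, b), fun i t => -(w i t)⁻¹, fun i => ⟨by simp [h0], by simp [h1], fun t ht => ?_⟩⟩
  have hn := hne i t ht
  refine ((hw i t ht).fun_inv hn).fun_neg.congr_deriv ?_
  field_simp
  ring

theorem reachRecip_add {ι : Type*} (u : ι → ℝ) (c : ℝ) (hc : ∀ i, |c| < |u i|) :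
    ReachRecip u (fun i => u i + c) := by
  refine reachRecip_of_hasDerivAt 0 c (fun i t => u i + t * c) (by simp) (by simp) ?_ ?_
  · intro i t ht h
    have h2 : |u i| = t * |c| := by
      rw [eq_neg_of_add_eq_zero_left h, abs_neg, abs_mul, abs_of_nonneg ht.1]
    nlinarith [hc i, ht.1, ht.2, abs_nonneg c]
  · intro i t _
    simpa using ((hasDerivAt_id t).mul_const c).const_add (u i)

theorem reachRecip_mul_sqrt {ι : Type*} (u : ι → ℝ) (c : ℝ) (hu : ∀ i, u i ≠ 0)
    (hc : ∀ i, 0 < 1 + 2 * c * (u i ^ 2)⁻¹) :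
    ReachRecip u (fun i => u i * √(1 + 2 * c * (u i ^ 2)⁻¹)) := by
  have hpos : ∀ i, ∀ t ∈ Icc (0 : ℝ) 1, 0 < 1 + 2 * (t * c) * (u i ^ 2)⁻¹ := by
    intro i t ht
    have h : 1 + 2 * (t * c) * (u i ^ 2)⁻¹ = (1 - t) + t * (1 + 2 * c * (u i ^ 2)⁻¹) := by ring
    rcases ht.1.eq_or_lt with h0 | h0
    · simp [← h0]
    · linarith [mul_pos h0 (hc i), ht.2]
  refine reachRecip_of_hasDerivAt (-c) 0
    (fun i t => u i * √(1 + 2 * (t * c) * (u i ^ 2)⁻¹)) (by simp) (by simp) ?_ ?_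
  · intro i t ht
    exact mul_ne_zero (hu i) (Real.sqrt_pos.2 (hpos i t ht)).ne'
  · intro i t ht
    have h := ((((((hasDerivAt_id t).mul_const c).const_mul 2).mul_const
      ((u i ^ 2)⁻¹)).const_add 1).sqrt (hpos i t ht).ne').const_mul (u i)
    refine h.congr_deriv ?_
    have h1 := (Real.sqrt_pos.2 (hpos i t ht)).ne'
    have h2 := hu i
    simp only [id]
    field_simp
    ring

/-- The flow of `c / (u - s)`, the field `1 / u` conjugated by the translation by `s`. -/
noncomputable def shiftedFlow (s c u : ℝ) : ℝ :=
  (u - s) * √(1 + 2 * c * ((u - s) ^ 2)⁻¹) + s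

theorem shiftedFlow_zero (s u : ℝ) : shiftedFlow s 0 u = u := by simp [shiftedFlow]

theorem reachRecip_shiftedFlow {ι : Type*} (u : ι → ℝ) (s c : ℝ) (hu : ∀ i, |s| < |u i|)
    (hc : ∀ i, 0 < 1 + 2 * c * ((u i - s) ^ 2)⁻¹) (hv : ∀ i, |s| < |shiftedFlow s c (u i)|) :
    ReachRecip u (fun i => shiftedFlow s c (u i)) := by
  have h1 : ReachRecip u (fun i => u i - s) := by
    simpa [sub_eq_add_neg] using reachRecip_add u (-s) (by simpa using hu)
  have h2 : ReachRecip (fun i => u i - s) (fun i => shiftedFlow s c (u i) - s) := by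
    have := reachRecip_mul_sqrt (fun i => u i - s) c
      (fun i h => (hu i).ne (by rw [sub_eq_zero.1 h])) hc
    simpa [shiftedFlow] using this
  have h3 : ReachRecip (fun i => shiftedFlow s c (u i)) (fun i => shiftedFlow s c (u i) - s) := by
    simpa [sub_eq_add_neg] using reachRecip_add (fun i => shiftedFlow s c (u i)) (-s)
      (by simpa using hv)
  exact (h1.trans h2).trans h3.symm

theorem HasStrictFDerivAt.shiftedFlow {E : Type*} [NormedAddCommGroup E] [NormedSpace ℝ E]
    {f g : E → ℝ} {f' g' : E →L[ℝ] ℝ} {a : E} (s : ℝ) (hf : HasStrictFDerivAt f f' a)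
    (hg : HasStrictFDerivAt g g' a) (hga : g a = 0) (hs : f a ≠ s) :
    HasStrictFDerivAt (fun t => shiftedFlow s (g t) (f t)) (f' + (f a - s)⁻¹ • g') a := by
  have hq := hf.sub_const s
  have hne : (f a - s) ^ 2 ≠ 0 := pow_ne_zero 2 (sub_ne_zero.2 hs)
  have hi := (hasStrictDerivAt_inv hne).comp_hasStrictFDerivAt a (hq.pow 2)
  have h := (hq.mul (((((hg.const_mul 2).mul hi).const_add 1)).sqrt
    (by simp [hga]))).add_const s
  refine (h.congr_fderiv ?_)
  ext v
  have : f a - s ≠ 0 := sub_ne_zero.2 hs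
  simp [hga]
  field_simp
  ring

/-- Successive application of the flows `shiftedFlow (s j) (t j)` for `j` in `l`. -/
noncomputable def iteratedFlow {ι : Type*} (s u : ι → ℝ) : List ι → (ι → ℝ) → ι → ℝ
  | [], _ => u
  | j :: l, t => fun i => shiftedFlow (s j) (t j) (iteratedFlow s u l t i)

theorem iteratedFlow_zero {ι : Type*} (s u : ι → ℝ) (l : List ι) :
    iteratedFlow s u l 0 = u := by
  induction l with
  | nil => rfl
  | cons j l ih => ext i; simp [iteratedFlow, ih, shiftedFlow_zero]

theorem hasStrictFDerivAt_iteratedFlow {ι : Type*} [Fintype ι] (s u : ι → ℝ)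
    (h : ∀ i j, u i ≠ s j) (l : List ι) (i : ι) :
    HasStrictFDerivAt (fun t => iteratedFlow s u l t i)
      ((l.map fun j => (u i - s j)⁻¹ •
        (ContinuousLinearMap.proj j : (ι → ℝ) →L[ℝ] ℝ)).sum) 0 := by
  induction l with
  | nil => simpa [iteratedFlow] using hasStrictFDerivAt_const (u i) (0 : ι → ℝ)
  | cons j l ih =>
    have := ih.shiftedFlow (s j)
      (ContinuousLinearMap.proj j : (ι → ℝ) →L[ℝ] ℝ).hasStrictFDerivAt (by simp)
      (by simpa [iteratedFlow_zero] using h i j)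
    simpa [iteratedFlow, iteratedFlow_zero, add_comm] using this

theorem eventually_reachRecip_iteratedFlow {ι : Type*} [Fintype ι] (s u : ι → ℝ)
    (h : ∀ i j, |s j| < |u i|) (l : List ι) :
    ∀ᶠ t in 𝓝 0, ReachRecip u (iteratedFlow s u l t) := by
  have hne : ∀ i j, u i ≠ s j := fun i j e => (h i j).ne (by rw [e])
  induction l with
  | nil => exact Eventually.of_forall fun _ => ReachRecip.refl u
  | cons j l ih =>
    have hcont : ∀ l i, ContinuousAt (fun t => iteratedFlow s u l t i) 0 :=
      fun l i => (hasStrictFDerivAt_iteratedFlow s u hne l i).continuousAt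
    have hlt : ∀ l, ∀ᶠ t in 𝓝 0, ∀ i, |s j| < |iteratedFlow s u l t i| := fun l =>
      eventually_all.2 fun i => (hcont l i).abs.eventually_const_lt
        (by simpa [iteratedFlow_zero] using h i j)
    have hpos : ∀ᶠ t in 𝓝 (0 : ι → ℝ), ∀ i,
        0 < 1 + 2 * t j * ((iteratedFlow s u l t i - s j) ^ 2)⁻¹ := by
      refine eventually_all.2 fun i => Tendsto.eventually_const_lt (by simp) (ContinuousAt.tendsto ?_)
      refine continuousAt_const.add (ContinuousAt.mul ?_ (ContinuousAt.inv₀ ?_ ?_))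
      · exact continuousAt_const.mul (continuous_apply j).continuousAt
      · exact ((hcont l i).sub continuousAt_const).pow 2
      · simpa [iteratedFlow_zero, sub_eq_zero] using hne i j
    filter_upwards [ih, hlt l, hlt (j :: l), hpos] with t h1 h2 h3 h4
    exact h1.trans (reachRecip_shiftedFlow _ (s j) (t j) h2 h4 h3)

/-- Nonsingularity of the Cauchy matrix `1 / (u i - s j)`. -/
theorem eq_zero_of_sum_inv_sub_mul_eq_zero {ι : Type*} [Fintype ι] {u s : ι → ℝ}
    (hu : Function.Injective u) (hs : Function.Injective s) (h : ∀ i j, u i ≠ s j) (t : ι → ℝ)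
    (ht : ∀ i, ∑ j, (u i - s j)⁻¹ * t j = 0) : t = 0 := by
  classical
  let P : Polynomial ℝ :=
    ∑ j, Polynomial.C (t j) * ∏ k ∈ Finset.univ.erase j, (Polynomial.X - Polynomial.C (s k))
  have hP : P = 0 := by
    refine Polynomial.eq_zero_of_degree_lt_of_eval_index_eq_zero Finset.univ (v := u)
      hu.injOn ?_ ?_
    · refine (Polynomial.degree_sum_le _ _).trans_lt ?_
      rw [Finset.sup_lt_iff (by exact WithBot.bot_lt_coe _)]
      intro j _
      rw [← Polynomial.smul_eq_C_mul]
      refine (Polynomial.degree_smul_le _ _).trans_lt ?_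
      rw [Polynomial.degree_prod]
      simp only [Polynomial.degree_X_sub_C, Finset.sum_const, nsmul_eq_mul, mul_one]
      exact_mod_cast Finset.card_erase_lt_of_mem (Finset.mem_univ j)
    · intro i _
      have : P.eval (u i) = (∏ k, (u i - s k)) * ∑ j, (u i - s j)⁻¹ * t j := by
        simp only [P, Polynomial.eval_finsetSum, Polynomial.eval_mul, Polynomial.eval_C,
          Polynomial.eval_prod, Polynomial.eval_sub, Polynomial.eval_X, Finset.mul_sum]
        refine Finset.sum_congr rfl fun j _ => ?_
        rw [← Finset.mul_prod_erase _ _ (Finset.mem_univ j)]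
        have := sub_ne_zero.2 (h i j)
        field_simp
      rw [this, ht, mul_zero]
  ext j
  have h0 : P.eval (s j) = t j * ∏ k ∈ Finset.univ.erase j, (s j - s k) := by
    simp only [P, Polynomial.eval_finsetSum, Polynomial.eval_mul, Polynomial.eval_C,
      Polynomial.eval_prod, Polynomial.eval_sub, Polynomial.eval_X]
    refine Finset.sum_eq_single_of_mem j (Finset.mem_univ j) fun k _ hk => ?_
    rw [Finset.prod_eq_zero (Finset.mem_erase.2 ⟨hk.symm, Finset.mem_univ j⟩) (sub_self _),
      mul_zero]
  rw [hP, Polynomial.eval_zero, eq_comm, mul_eq_zero] at h0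
  refine h0.resolve_right (Finset.prod_ne_zero_iff.2 fun k hk => sub_ne_zero.2 fun e => ?_)
  exact (Finset.ne_of_mem_erase hk) (hs e).symm

/-- Orbits are neighbourhoods of each of their points with distinct nonzero coordinates. -/
theorem eventually_reachRecip {ι : Type*} [Fintype ι] (u : ι → ℝ) (hu : Function.Injective u)
    (hu0 : ∀ i, u i ≠ 0) : ∀ᶠ v in 𝓝 u, ReachRecip u v := by
  obtain ⟨δ, hδ, hδ0⟩ : ∃ δ : ℝ, (∀ i, δ < |u i|) ∧ 0 < δ := by
    have h1 : ∀ᶠ δ in 𝓝[>] (0 : ℝ), ∀ i, δ < |u i| := eventually_all.2 fun i =>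
      (eventually_lt_nhds (abs_pos.2 (hu0 i))).filter_mono nhdsWithin_le_nhds
    exact (h1.and self_mem_nhdsWithin).exists
  have : Infinite (Ioo 0 δ) := (Ioo_infinite hδ0).to_subtype
  obtain ⟨e⟩ : Nonempty (ι ↪ Ioo 0 δ) :=
    ⟨((Fintype.equivFin ι).toEmbedding.trans Fin.valEmbedding).trans (Infinite.natEmbedding _)⟩
  let s : ι → ℝ := fun j => e j
  have hs : Function.Injective s := Subtype.val_injective.comp e.injective
  have hlt : ∀ i j, |s j| < |u i| := fun i j => by
    rw [abs_of_pos (e j).2.1]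
    exact (e j).2.2.trans (hδ i)
  have hne : ∀ i j, u i ≠ s j := fun i j e => (hlt i j).ne (by rw [e])
  let D : (ι → ℝ) →L[ℝ] (ι → ℝ) := ContinuousLinearMap.pi fun i =>
    (Finset.univ.toList.map fun j => (u i - s j)⁻¹ •
        (ContinuousLinearMap.proj j : (ι → ℝ) →L[ℝ] ℝ)).sum
  have hD : HasStrictFDerivAt (iteratedFlow s u Finset.univ.toList) D 0 :=
    hasStrictFDerivAt_pi.2 fun i => hasStrictFDerivAt_iteratedFlow s u hne _ i
  have hsurj : D.range = ⊤ := by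
    refine LinearMap.range_eq_top.2 (LinearMap.surjective_of_injective ?_)
    refine (injective_iff_map_eq_zero _).2 fun t ht => ?_
    refine eq_zero_of_sum_inv_sub_mul_eq_zero hu hs hne t fun i => ?_
    have := congrFun ht i
    simpa [D, Finset.sum_map_toList] using this
  have hmap := hD.map_nhds_eq_of_surj hsurj
  rw [iteratedFlow_zero] at hmap
  rw [← hmap]
  exact eventually_reachRecip_iteratedFlow s u hlt _

theorem reachRecip_of_ordered {n M : ℕ} {u v : Fin n → ℝ}
    (hu : ∀ i j : Fin n, i < j → ((i : ℕ) < M ↔ (j : ℕ) < M) → u i < u j)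
    (hv : ∀ i j : Fin n, i < j → ((i : ℕ) < M ↔ (j : ℕ) < M) → v i < v j)
    (hupos : ∀ i : Fin n, (i : ℕ) < M → 0 < u i) (huneg : ∀ i : Fin n, M ≤ (i : ℕ) → u i < 0)
    (hvpos : ∀ i : Fin n, (i : ℕ) < M → 0 < v i) (hvneg : ∀ i : Fin n, M ≤ (i : ℕ) → v i < 0) :
    ReachRecip u v := by
  let S : Set (Fin n → ℝ) := {w | (∀ i j : Fin n, i < j → ((i : ℕ) < M ↔ (j : ℕ) < M) → w i < w j) ∧
    (∀ i : Fin n, (i : ℕ) < M → 0 < w i) ∧ ∀ i : Fin n, M ≤ (i : ℕ) → w i < 0}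
  have hconv : Convex ℝ S := by
    rw [convex_iff_forall_pos]
    rintro a ⟨ha, hap, han⟩ b ⟨hb, hbp, hbn⟩ p q hp hq _
    refine ⟨fun i j hij hM => ?_, fun i hi => ?_, fun i hi => ?_⟩ <;>
      simp only [Pi.add_apply, Pi.smul_apply, smul_eq_mul]
    · have := ha i j hij hM
      have := hb i j hij hM
      gcongr
    · have := hap i hi
      have := hbp i hi
      positivity
    · nlinarith [mul_pos hp (neg_pos.2 (han i hi)), mul_pos hq (neg_pos.2 (hbn i hi))]
  have hne : ∀ w ∈ S, ∀ i j : Fin n, i < j → w i ≠ w j := by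
    rintro w ⟨hw, hp, hn⟩ i j hij e
    have hij' : (i : ℕ) < j := hij
    rcases lt_or_ge (j : ℕ) M with hj | hj
    · exact (hw i j hij (by omega)).ne e
    · rcases lt_or_ge (i : ℕ) M with hi | hi
      · linarith [hp i hi, hn j hj]
      · exact (hw i j hij (by omega)).ne e
  refine hconv.isPreconnected.induction₂' ReachRecip (fun w hw => ?_)
    (fun _ _ _ _ _ _ => ReachRecip.trans) (x := u) (y := v) ⟨hu, hupos, huneg⟩ ⟨hv, hvpos, hvneg⟩
  have hinj : Function.Injective w := fun i j e => by
    rcases lt_trichotomy i j with h | h | h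
    · exact absurd e (hne w hw i j h)
    · exact h
    · exact absurd e.symm (hne w hw j i h)
  have hw0 : ∀ i, w i ≠ 0 := fun i => by
    rcases lt_or_ge (i : ℕ) M with hi | hi
    · exact (hw.2.1 i hi).ne'
    · exact (hw.2.2 i hi).ne
  filter_upwards [(eventually_reachRecip w hinj hw0).filter_mono nhdsWithin_le_nhds] with z hz
  exact ⟨hz, hz.symm⟩

/-- Concatenation of a chain of unit-time steps. -/
theorem exists_control_of_reflTransGen {ι : Type*} {x y : ι → ℝ}
    (h : Relation.ReflTransGen CubicStep x y) :
    ∃ m : ℕ, 0 < m ∧ ∃ (θ : ℕ → ℝ × ℝ) (γ : ι → ℝ → ℝ), ∀ i,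
      ContinuousOn (γ i) (Icc 0 m) ∧ γ i 0 = x i ∧ γ i m = y i ∧
      ∀ k < m, ∀ t ∈ Ioo (k : ℝ) (k + 1),
        HasDerivAt (γ i) ((θ k).1 * γ i t ^ 3 + (θ k).2 * γ i t ^ 2) t := by
  induction h with
  | refl =>
    refine ⟨1, one_pos, fun _ => 0, fun i _ => x i, fun i =>
      ⟨continuousOn_const, rfl, rfl, fun k _ t _ => ?_⟩⟩
    simpa using hasDerivAt_const t (x i)
  | tail _ hstep ih =>
    obtain ⟨m, hm, θ, γ, hγ⟩ := ih
    obtain ⟨c, η, hη⟩ := hstep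
    refine ⟨m + 1, m.succ_pos, Function.update θ m c,
      fun i t => if t ≤ m then γ i t else η i (t - m), fun i => ?_⟩
    obtain ⟨hc, h0, h1, hd⟩ := hγ i
    obtain ⟨e0, e1, ed⟩ := hη i
    refine ⟨?_, by simp [h0], by simp [e1], fun k hk t ht => ?_⟩
    · have hc2 : ContinuousOn (fun t => η i (t - m)) (Icc (m : ℝ) (m + 1)) := fun t ht =>
        (ContinuousAt.comp (f := fun t : ℝ => t - m)
          (ed (t - m) ⟨by linarith [ht.1], by linarith [ht.2]⟩).continuousAt
          (by fun_prop)).continuousWithinAt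
      have hc1 : ContinuousOn (fun t : ℝ => if t ≤ m then γ i t else η i (t - m)) (Icc (0 : ℝ) m) :=
        hc.congr fun t ht => if_pos ht.2
      have hc3 : ContinuousOn (fun t : ℝ => if t ≤ m then γ i t else η i (t - m))
          (Icc (m : ℝ) (m + 1)) := hc2.congr fun t ht => by
        rcases ht.1.eq_or_lt with e | e
        · simp [← e, h1, e0]
        · exact if_neg e.not_ge
      have := hc1.union_of_isClosed hc3 isClosed_Icc isClosed_Icc
      rwa [Icc_union_Icc_eq_Icc (by positivity) (by linarith), ← Nat.cast_add_one] at this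
    · rcases (Nat.lt_succ_iff.1 hk).eq_or_lt with rfl | hk
      · have ht1 : ¬ t ≤ k := ht.1.not_ge
        have := (ed (t - k) ⟨by linarith [ht.1], by linarith [ht.2]⟩).scomp t
          ((hasDerivAt_id t).sub_const (k : ℝ))
        simp only [one_smul] at this
        simp only [Function.update_self, if_neg ht1]
        refine this.congr_of_eventuallyEq ?_
        filter_upwards [lt_mem_nhds ht.1] with r hr
        simp [hr.not_ge]
      · have hkm : (k : ℝ) + 1 ≤ m := by exact_mod_cast hk
        have ht1 : t < m := ht.2.trans_le hkm
        simp only [Function.update_of_ne hk.ne, if_pos ht1.le]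
        refine (hd k hk t ht).congr_of_eventuallyEq ?_
        filter_upwards [gt_mem_nhds ht1] with r hr
        simp [hr.le]


/-- The one-dimensional control system `ẋ = θ₁x³ + θ₂x²` can exactly steer any
ordered ensemble `x₁ < ⋯ < x_M < 0 < x_{M+1} < ⋯ < x_{M+N}` to any ordered ensemble
`y₁ < ⋯ < y_M < 0 < y_{M+1} < ⋯ < y_{M+N}` with a single piecewise constant control. -/
theorem one_dim_cubic_system_interpolation
    (M N : ℕ) (hM : 0 < M) (hN : 0 < N)
    (x y : Fin (M + N) → ℝ)
    (hxmono : StrictMono x) (hymono : StrictMono y)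
    (hxneg : ∀ i : Fin (M + N), (i : ℕ) < M → x i < 0)
    (hxpos : ∀ i : Fin (M + N), M ≤ (i : ℕ) → 0 < x i)
    (hyneg : ∀ i : Fin (M + N), (i : ℕ) < M → y i < 0)
    (hypos : ∀ i : Fin (M + N), M ≤ (i : ℕ) → 0 < y i) :
    ∃ T : ℝ, 0 < T ∧
    ∃ (θ : ℝ → ℝ × ℝ) (m : ℕ) (τ : Fin (m + 1) → ℝ),
      StrictMono τ ∧ τ 0 = 0 ∧ τ (Fin.last m) = T ∧
      (∀ j : Fin m, ∀ s ∈ Set.Ico (τ j.castSucc) (τ j.succ), θ s = θ (τ j.castSucc)) ∧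
      ∃ γ : Fin (M + N) → ℝ → ℝ,
        ∀ i : Fin (M + N),
          ContinuousOn (γ i) (Set.Icc 0 T) ∧
          γ i 0 = x i ∧ γ i T = y i ∧
          ∀ t ∈ Set.Icc (0 : ℝ) T, (∀ j : Fin (m + 1), t ≠ τ j) →
            HasDerivAt (γ i) ((θ t).1 * γ i t ^ 3 + (θ t).2 * γ i t ^ 2) t := by
  have hlt : ∀ z : Fin (M + N) → ℝ, StrictMono z → (∀ i : Fin (M + N), (i : ℕ) < M → z i < 0) →
      (∀ i : Fin (M + N), M ≤ (i : ℕ) → 0 < z i) →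
      ∀ i j : Fin (M + N), i < j → ((i : ℕ) < M ↔ (j : ℕ) < M) → -(z i)⁻¹ < -(z j)⁻¹ := by
    intro z hz hn hp i j hij hiff
    rw [neg_lt_neg_iff]
    rcases lt_or_ge (j : ℕ) M with hj | hj
    · exact (inv_lt_inv_of_neg (hn j hj) (hn i (hiff.2 hj))).2 (hz hij)
    · exact (inv_lt_inv₀ (hp j hj) (hp i (by omega))).2 (hz hij)
  have hreach : ReachRecip (fun i => -(x i)⁻¹) (fun i => -(y i)⁻¹) :=
    reachRecip_of_ordered (M := M) (hlt x hxmono hxneg hxpos) (hlt y hymono hyneg hypos)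
      (fun i hi => neg_pos.2 (inv_lt_zero.2 (hxneg i hi)))
      (fun i hi => neg_lt_zero.2 (inv_pos.2 (hxpos i hi)))
      (fun i hi => neg_pos.2 (inv_lt_zero.2 (hyneg i hi)))
      (fun i hi => neg_lt_zero.2 (inv_pos.2 (hypos i hi)))
  obtain ⟨m, hm, θ, γ, hγ⟩ := exists_control_of_reflTransGen hreach
  refine ⟨m, Nat.cast_pos.2 hm, fun t => θ ⌊t⌋₊, m, fun j => ((j : ℕ) : ℝ),
    fun i j hij => Nat.cast_lt.2 hij, by simp, by simp, ?_, γ, fun i => ?_⟩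
  · intro j s hs
    have : ⌊s⌋₊ = (j : ℕ) := (Nat.floor_eq_iff ((Nat.cast_nonneg _).trans hs.1)).2
      (by simpa using hs)
    simp [this]
  · obtain ⟨hc, h0, h1, hd⟩ := hγ i
    refine ⟨hc, by simpa using h0, by simpa using h1, fun t ht hne => ?_⟩
    have hk : ⌊t⌋₊ ≤ m := Nat.floor_le_of_le ht.2
    have h2 : (⌊t⌋₊ : ℝ) < t := lt_of_le_of_ne (Nat.floor_le ht.1)
      (hne ⟨⌊t⌋₊, Nat.lt_succ_of_le hk⟩).symm
    have hk' : ⌊t⌋₊ < m := by exact_mod_cast h2.trans_le ht.2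
    exact hd _ hk' t ⟨h2, Nat.lt_floor_add_one t⟩
end

section
/- Consider the two-dimensional control system ẋ₁ = θ₁ x₁³ + θ₂ x₁² + θ₃ x₂, ẋ₂ = θ₄ x₂³ + θ₅ x₂² + θ₆ x₁ with control parameter θ = (θ₁, …, θ₆) ∈ ℝ⁶. For every N, all pairwise distinct nonzero points x^{(1)}, …, x^{(N)} ∈ ℝ² \ {0} and all pairwise distinct nonzero points y^{(1)}, …, y^{(N)} ∈ ℝ² \ {0}, there exist T > 0, a piecewise constant control θ : [0,T] → ℝ⁶, and continuous curves γ_1, …, γ_N : [0,T] → ℝ² solving the system with control θ(t) at every non-switching time, such that γ_i(0) = x^{(i)} and γ_i(T) = y^{(i)} for every i. -/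
open Set Filter Topology

/-- The vector field of the control system at the point `p` for the control value `c`. -/
def cubicField (c : Fin 6 → ℝ) (p : ℝ × ℝ) : ℝ × ℝ :=
  (c 0 * p.1 ^ 3 + c 1 * p.1 ^ 2 + c 2 * p.2, c 3 * p.2 ^ 3 + c 4 * p.2 ^ 2 + c 5 * p.1)

/-- `y` is reached from `x` in unit time with a constant control. -/
def ConstSteer {N : ℕ} (x y : Fin N → ℝ × ℝ) : Prop :=
  ∃ c : Fin 6 → ℝ, ∃ γ : Fin N → ℝ → ℝ × ℝ, ∀ i,
    γ i 0 = x i ∧ γ i 1 = y i ∧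
      ∀ t ∈ Icc (0 : ℝ) 1, HasDerivAt (γ i) (cubicField c (γ i t)) t

/-- `y` is reached from `x` in time `T` with a piecewise constant control. -/
def SteerIn {N : ℕ} (T : ℝ) (x y : Fin N → ℝ × ℝ) : Prop :=
  ∃ (θ : ℝ → Fin 6 → ℝ) (m : ℕ) (τ : Fin (m + 1) → ℝ),
    StrictMono τ ∧ τ 0 = 0 ∧ τ (Fin.last m) = T ∧
    (∀ j : Fin m, ∀ s ∈ Ico (τ j.castSucc) (τ j.succ), θ s = θ (τ j.castSucc)) ∧
    ∃ γ : Fin N → ℝ → ℝ × ℝ, ∀ i : Fin N,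
      ContinuousOn (γ i) (Icc 0 T) ∧ γ i 0 = x i ∧ γ i T = y i ∧
      ∀ t ∈ Icc (0 : ℝ) T, (∀ j : Fin (m + 1), t ≠ τ j) →
        HasDerivAt (γ i) (cubicField (θ t) (γ i t)) t

theorem SteerIn.refl {N : ℕ} (x : Fin N → ℝ × ℝ) : SteerIn 0 x x := by
  refine ⟨fun _ _ => 0, 0, fun _ => 0, fun a b h => absurd h (by omega), rfl, rfl, fun j => j.elim0,
    fun i _ => x i, fun i => ⟨continuousOn_const, rfl, rfl, fun t ht h => ?_⟩⟩
  exact absurd (le_antisymm ht.2 ht.1) (h 0)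

theorem SteerIn.append {N : ℕ} {T : ℝ} {x y z : Fin N → ℝ × ℝ} (hT : 0 ≤ T)
    (hxy : SteerIn T x y) (hyz : ConstSteer y z) : SteerIn (T + 1) x z := by
  obtain ⟨θ, m, τ, hτ, hτ0, hτT, hθ, γ, hγ⟩ := hxy
  obtain ⟨c, δ, hδ⟩ := hyz
  have hle : ∀ j, τ j ≤ T := fun j => hτT ▸ hτ.monotone (Fin.le_last j)
  refine ⟨fun s => if s < T then θ s else c, m + 1, Fin.snoc (α := fun _ => ℝ) τ (T + 1),
    ?_, ?_, by simp, ?_, fun i t => if t ≤ T then γ i t else δ i (t - T), fun i => ?_⟩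
  · refine Fin.strictMono_iff_lt_succ.2 fun j => ?_
    induction j using Fin.lastCases with
    | last => simp [hτT]
    | cast j =>
      rw [Fin.succ_castSucc, Fin.snoc_castSucc, Fin.snoc_castSucc]
      exact hτ j.castSucc_lt_succ
  · rw [← Fin.castSucc_zero, Fin.snoc_castSucc, hτ0]
  · intro j s hs
    induction j using Fin.lastCases with
    | last =>
      simp only [Fin.snoc_castSucc, hτT, Fin.succ_last, Fin.snoc_last] at hs ⊢
      simp [hs.1]
    | cast j =>
      rw [Fin.succ_castSucc, Fin.snoc_castSucc, Fin.snoc_castSucc] at hs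
      rw [Fin.snoc_castSucc]
      have h1 : s < T := hs.2.trans_le (hle _)
      have h2 : τ j.castSucc < T := hs.1.trans_lt h1
      simp only [h1, h2, if_true]
      exact hθ j s hs
  · obtain ⟨hc, h0, h1, hd⟩ := hγ i
    obtain ⟨k0, k1, kd⟩ := hδ i
    refine ⟨?_, by simp [hT, h0], by simp [k1], fun t ht hne => ?_⟩
    · have hδc : ContinuousOn (fun t => δ i (t - T)) (Icc T (T + 1)) := by
        intro t ht
        have h := (kd (t - T) ⟨by linarith [ht.1], by linarith [ht.2]⟩).continuousAt
        exact (ContinuousAt.comp (f := fun t : ℝ => t - T) h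
          (by fun_prop)).continuousWithinAt
      rw [← Icc_union_Icc_eq_Icc hT (by linarith : T ≤ T + 1)]
      refine ContinuousOn.union_of_isClosed ?_ ?_ isClosed_Icc isClosed_Icc
      · exact hc.congr fun t ht => if_pos ht.2
      · refine hδc.congr fun t ht => ?_
        rcases ht.1.eq_or_lt with rfl | h
        · simp [h1, k0]
        · exact if_neg h.not_ge
    · have hne' : ∀ j, t ≠ τ j := fun j => by simpa using hne j.castSucc
      have htT : t ≠ T := hτT ▸ hne' (Fin.last m)
      rcases htT.lt_or_gt with h | h
      · have key := hd t ⟨ht.1, h.le⟩ hne'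
        simp only [h, h.le, if_true]
        refine key.congr_of_eventuallyEq ?_
        filter_upwards [Iio_mem_nhds h] with s hs using if_pos (le_of_lt hs)
      · have key := (kd (t - T) ⟨by linarith, by linarith [ht.2]⟩).comp_sub_const t T
        simp only [h.not_gt, h.not_ge, if_false]
        refine key.congr_of_eventuallyEq ?_
        filter_upwards [Ioi_mem_nhds h] with s hs using if_neg (not_le_of_gt hs)

/-- Constant control steering is preserved by exchanging the two coordinates. -/
theorem ConstSteer.swap {N : ℕ} {x y : Fin N → ℝ × ℝ} (h : ConstSteer x y) :
    ConstSteer (fun i => (x i).swap) (fun i => (y i).swap) := by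
  obtain ⟨c, γ, h⟩ := h
  refine ⟨![c 3, c 4, c 5, c 0, c 1, c 2], fun i t => (γ i t).swap, fun i => ?_⟩
  obtain ⟨h0, h1, hd⟩ := h i
  refine ⟨by simp [h0], by simp [h1], fun t ht => ?_⟩
  exact (hd t ht).snd.prodMk (hd t ht).fst

theorem ConstSteer.refl {N : ℕ} (x : Fin N → ℝ × ℝ) : ConstSteer x x :=
  ⟨fun _ => 0, fun i _ => x i, fun i => ⟨rfl, rfl, fun t _ =>
    (hasDerivAt_const t (x i)).congr_deriv (by ext <;> simp [cubicField])⟩⟩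

/-- The vertical shear, the flow of the control `θ₆`. -/
theorem constSteer_shear {N : ℕ} (s : ℝ) (u v : Fin N → ℝ) :
    ConstSteer (fun i => (u i, v i)) (fun i => (u i, v i + s * u i)) := by
  refine ⟨![0, 0, 0, 0, 0, s], fun i r => (u i, v i + r * (s * u i)), fun i =>
    ⟨by simp, by simp, fun r _ => ?_⟩⟩
  have h : HasDerivAt (fun r : ℝ => (u i, v i + r * (s * u i))) (0, 1 * (s * u i)) r :=
    (hasDerivAt_const r (u i)).prodMk (((hasDerivAt_id r).mul_const _).const_add _)
  simpa [cubicField] using h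

/-- The flow of the quadratic control `θ₂`. -/
theorem constSteer_quadratic {N : ℕ} (t : ℝ) (u v : Fin N → ℝ) (h : ∀ i, t * u i < 1) :
    ConstSteer (fun i => (u i, v i)) (fun i => (u i / (1 - t * u i), v i)) := by
  refine ⟨![0, t, 0, 0, 0, 0], fun i r => (u i / (1 - r * (t * u i)), v i), fun i =>
    ⟨by simp, by simp, fun r hr => ?_⟩⟩
  have hpos : 1 - r * (t * u i) ≠ 0 := by
    have := h i
    have h1 := hr.1
    have h2 := hr.2
    apply ne_of_gt
    rcases le_total (t * u i) 0 with h3 | h3 <;> nlinarith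
  have h1 : HasDerivAt (fun r : ℝ => 1 - r * (t * u i)) (-(1 * (t * u i))) r :=
    ((hasDerivAt_id r).mul_const _).const_sub _
  refine (((hasDerivAt_const r (u i)).div h1 hpos).prodMk
    (hasDerivAt_const r (v i))).congr_deriv (Prod.ext ?_ ?_)
  · simp only [cubicField, Fin.isValue, Matrix.cons_val]
    rw [div_pow, div_pow]
    ring
  · simp [cubicField]

/-- `y` is reached from `x` by finitely many unit time steps with constant controls. -/
abbrev Steer {N : ℕ} (x y : Fin N → ℝ × ℝ) : Prop := Relation.ReflTransGen ConstSteer x y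

theorem Steer.swap {N : ℕ} {x y : Fin N → ℝ × ℝ} (h : Steer x y) :
    Steer (fun i => (x i).swap) (fun i => (y i).swap) :=
  Relation.ReflTransGen.lift (p := ConstSteer) (fun (x : Fin N → ℝ × ℝ) i => (x i).swap)
    (fun _ _ => ConstSteer.swap) _ _ h

/-- Conjugating the vertical shear by the quadratic flow gives a rational shear. -/
theorem steer_rational_shear {N : ℕ} (s t : ℝ) (u v : Fin N → ℝ) (h : ∀ i, t * u i < 1) :
    Steer (fun i => (u i, v i)) (fun i => (u i, v i + s * (u i / (1 - t * u i)))) := by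
  refine ((Relation.ReflTransGen.single (constSteer_quadratic t u v h)).tail
    (constSteer_shear s _ _)).tail ?_
  have hid : ∀ i, 1 - -t * (u i / (1 - t * u i)) = 1 / (1 - t * u i) := fun i => by
    have : 1 - t * u i ≠ 0 := by linarith [h i]
    field_simp
    ring
  convert constSteer_quadratic (-t) (fun i => u i / (1 - t * u i)) _ (fun i => ?_) using 3 with i
  · have : 1 - t * u i ≠ 0 := by linarith [h i]
    rw [hid, div_div_div_cancel_right₀ this, div_one]
  · have h1 : 0 < 1 / (1 - t * u i) := one_div_pos.2 (by linarith [h i])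
    linarith [hid i]

theorem steer_sum_rational_shear {N : ℕ} {ι : Type*} (K : Finset ι) (s t : ι → ℝ)
    (u v : Fin N → ℝ) (h : ∀ k i, t k * u i < 1) :
    Steer (fun i => (u i, v i))
      (fun i => (u i, v i + ∑ k ∈ K, s k * (u i / (1 - t k * u i)))) := by
  classical
  induction K using Finset.induction_on with
  | empty => simpa using Relation.ReflTransGen.refl
  | insert a K ha ih =>
    refine ih.trans ?_
    convert steer_rational_shear (s a) (t a) u _ (h a) using 3 with i
    rw [Finset.sum_insert ha]
    ring

/-- Interpolation by sums of simple fractions with prescribed poles. -/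
theorem exists_sum_inv_sub_eq {ι : Type*} [Fintype ι] (a t w : ι → ℝ)
    (ha : Function.Injective a) (ht : Function.Injective t) (hat : ∀ i k, a i ≠ t k) :
    ∃ s : ι → ℝ, ∀ i, ∑ k, s k * (a i - t k)⁻¹ = w i := by
  classical
  let n := Lagrange.nodal Finset.univ t
  let P := Lagrange.interpolate Finset.univ a fun i => n.eval (a i) * w i
  refine ⟨fun k => Lagrange.nodalWeight Finset.univ t k * P.eval (t k), fun i => ?_⟩
  have hP : P = Lagrange.interpolate Finset.univ t fun k => P.eval (t k) :=
    Lagrange.eq_interpolate ht.injOn (Lagrange.degree_interpolate_lt _ ha.injOn)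
  have h1 : P.eval (a i) = n.eval (a i) * w i :=
    Lagrange.eval_interpolate_at_node _ ha.injOn (Finset.mem_univ i)
  have h2 := Lagrange.eval_interpolate_not_at_node (s := Finset.univ) (v := t)
    (fun k => P.eval (t k)) (x := a i) fun k _ => hat i k
  rw [← hP, h1] at h2
  have hn : n.eval (a i) ≠ 0 := by
    simp only [n, Lagrange.eval_nodal, Finset.prod_ne_zero_iff]
    exact fun k _ => sub_ne_zero.2 (hat i k)
  rw [mul_left_cancel₀ hn h2]
  exact Finset.sum_congr rfl fun k _ => by ring

/-- Second coordinates can be prescribed when the first ones are distinct and nonzero. -/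
theorem steer_snd {N : ℕ} (u v w : Fin N → ℝ) (hu : Function.Injective u)
    (hu0 : ∀ i, u i ≠ 0) : Steer (fun i => (u i, v i)) (fun i => (u i, w i)) := by
  let B : ℝ := 1 + ∑ i, |u i|
  have hB : ∀ i, |u i| < B := fun i => by
    have := Finset.single_le_sum (f := fun i => |u i|) (fun i _ => abs_nonneg _)
      (Finset.mem_univ i)
    simp only [B]
    linarith
  let t : Fin N → ℝ := fun k => (B + k)⁻¹
  have ht : Function.Injective t := fun j k h => by
    have h' := add_left_cancel (inv_injective h)
    exact Fin.ext (by exact_mod_cast h')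
  have htu : ∀ k i, t k * u i < 1 := fun k i => by
    have h1 := hB i
    have h2 := abs_nonneg (u i)
    have h3 := le_abs_self (u i)
    have h4 : (0 : ℝ) ≤ (k : ℕ) := Nat.cast_nonneg _
    rw [inv_mul_lt_iff₀ (by linarith)]
    linarith
  obtain ⟨s, hs⟩ := exists_sum_inv_sub_eq (fun i => (u i)⁻¹) t (fun i => w i - v i)
    (inv_injective.comp hu) ht fun i k h => by
      have := htu k i
      rw [← h, inv_mul_cancel₀ (hu0 i)] at this
      exact lt_irrefl _ this
  convert steer_sum_rational_shear Finset.univ s t u v htu using 3 with i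
  rw [← sub_eq_iff_eq_add', ← hs i]
  refine Finset.sum_congr rfl fun k _ => ?_
  have h1 : 1 - t k * u i ≠ 0 := by linarith [htu k i]
  have h2 : (u i)⁻¹ - t k = (1 - t k * u i) / u i := by
    have := hu0 i
    field_simp
  rw [h2, inv_div]

theorem steer_fst {N : ℕ} (u v w : Fin N → ℝ) (hv : Function.Injective v)
    (hv0 : ∀ i, v i ≠ 0) : Steer (fun i => (u i, v i)) (fun i => (w i, v i)) :=
  (steer_snd v u w hv hv0).swap

/-- A generic horizontal shear makes the first coordinates distinct and nonzero. -/
theorem exists_shear_injective {ι : Type*} [Finite ι] (x : ι → ℝ × ℝ)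
    (hx : Function.Injective x) (hx0 : ∀ i, x i ≠ 0) :
    ∃ s : ℝ, Function.Injective (fun i => (x i).1 + s * (x i).2) ∧
      ∀ i, (x i).1 + s * (x i).2 ≠ 0 := by
  have hfin : ∀ p : ℝ × ℝ, p ≠ 0 → {s : ℝ | p.1 + s * p.2 = 0}.Finite := by
    refine fun p hp => Set.Subsingleton.finite fun s hs r hr => ?_
    simp only [mem_ofPred_eq] at hs hr
    by_cases h2 : p.2 = 0
    · exact absurd (Prod.ext (by simpa [h2] using hs) h2) hp
    · exact mul_right_cancel₀ h2 (by linarith)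
  have h1 : (⋃ i, {s : ℝ | (x i).1 + s * (x i).2 = 0}).Finite :=
    finite_iUnion fun i => hfin _ (hx0 i)
  have h2 : (⋃ q : {q : ι × ι // q.1 ≠ q.2},
      {s : ℝ | (x q.1.1 - x q.1.2).1 + s * (x q.1.1 - x q.1.2).2 = 0}).Finite :=
    finite_iUnion fun q => hfin _ (sub_ne_zero.2 (hx.ne q.2))
  obtain ⟨s, hs⟩ := (h1.union h2).exists_notMem
  simp only [mem_union, mem_iUnion, mem_ofPred_eq, not_or, not_exists] at hs
  refine ⟨s, fun i j hij => ?_, hs.1⟩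
  by_contra hne
  refine hs.2 ⟨(i, j), hne⟩ ?_
  simp only [Prod.fst_sub, Prod.snd_sub] at hij ⊢
  linarith

theorem steer_of_injective {N : ℕ} (x y : Fin N → ℝ × ℝ)
    (hx : Function.Injective x) (hy : Function.Injective y)
    (hx0 : ∀ i, x i ≠ 0) (hy0 : ∀ i, y i ≠ 0) : Steer x y := by
  obtain ⟨s, hs, hs0⟩ := exists_shear_injective x hx hx0
  obtain ⟨r, hr, hr0⟩ := exists_shear_injective y hy hy0
  let e : Fin N → ℝ := fun i => (i : ℕ) + 1
  have he : Function.Injective e := fun i j h => Fin.ext (by simpa [e] using h)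
  have he0 : ∀ i, e i ≠ 0 := fun i => Nat.cast_add_one_ne_zero _
  have hfirst : Steer x fun i => ((x i).1 + s * (x i).2, (x i).2) :=
    .single (constSteer_shear s (fun i => (x i).2) fun i => (x i).1).swap
  have hlast : Steer (fun i => ((y i).1 + r * (y i).2, (y i).2)) y := by
    refine .single ?_
    convert (constSteer_shear (-r) (fun i => (y i).2) fun i => (y i).1 + r * (y i).2).swap
      using 2 with i
    · simp
    · exact Prod.ext (by simp) rfl
  exact (((hfirst.trans (steer_snd _ _ e hs hs0)).trans (steer_fst _ e _ he he0)).trans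
    (steer_snd _ e _ hr hr0)).trans hlast

theorem Steer.exists_steerIn {N : ℕ} {x y : Fin N → ℝ × ℝ} (h : Steer x y) :
    ∃ T : ℝ, 0 ≤ T ∧ SteerIn T x y := by
  induction h with
  | refl => exact ⟨0, le_rfl, .refl x⟩
  | tail _ hyz ih =>
    obtain ⟨T, hT, h⟩ := ih
    exact ⟨T + 1, by linarith, h.append hT hyz⟩

/-- Lemma 3.10: the two-dimensional control system
`ẋ₁ = θ₁x₁³ + θ₂x₁² + θ₃x₂`, `ẋ₂ = θ₄x₂³ + θ₅x₂² + θ₆x₁` can exactly steer any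
pairwise distinct ensemble of nonzero points to any pairwise distinct ensemble of
nonzero points with a single piecewise constant control. -/
theorem two_dim_polynomial_system_interpolation
    (N : ℕ) (x y : Fin N → ℝ × ℝ)
    (hx : Function.Injective x) (hy : Function.Injective y)
    (hx0 : ∀ i, x i ≠ 0) (hy0 : ∀ i, y i ≠ 0) :
    ∃ T : ℝ, 0 < T ∧
    ∃ (θ : ℝ → Fin 6 → ℝ) (m : ℕ) (τ : Fin (m + 1) → ℝ),
      StrictMono τ ∧ τ 0 = 0 ∧ τ (Fin.last m) = T ∧
      (∀ j : Fin m, ∀ s ∈ Set.Ico (τ j.castSucc) (τ j.succ), θ s = θ (τ j.castSucc)) ∧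
      ∃ γ : Fin N → ℝ → ℝ × ℝ,
        ∀ i : Fin N,
          ContinuousOn (γ i) (Set.Icc 0 T) ∧
          γ i 0 = x i ∧ γ i T = y i ∧
          ∀ t ∈ Set.Icc (0 : ℝ) T, (∀ j : Fin (m + 1), t ≠ τ j) →
            HasDerivAt (γ i)
              (θ t 0 * (γ i t).1 ^ 3 + θ t 1 * (γ i t).1 ^ 2 + θ t 2 * (γ i t).2,
                θ t 3 * (γ i t).2 ^ 3 + θ t 4 * (γ i t).2 ^ 2 + θ t 5 * (γ i t).1) t := by
  obtain ⟨T, hT, h⟩ := (steer_of_injective x y hx hy hx0 hy0).exists_steerIn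
  exact ⟨T + 1, by linarith, h.append hT (.refl y)⟩
end
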